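/- There exists a constant C > 0 such that for every i_max ≥ 1, with N = 2·lcm(1, 2, …, i_max), for every integer i with 1 ≤ i ≤ i_max and every integer q with N/(2(i+1)) < q ≤ N/(2i), one has | I_N((q+1)/(2q+1)) − |F_N|/2 − (3/π²)·N²/(4q) | ≤ C·N. -/

import Mathlib

/-- The Farey sequence of order `N`, as the finite set of all rationals `h/k`
with `0 ≤ h ≤ k ≤ N`. -/
def farey (N : ℕ) : Finset ℚ :=
  (Finset.range (N + 1)).biUnion fun k => (Finset.range (k + 1)).image fun h : ℕ => (h : ℚ) / (k : ℚ)

/-- `I_N(x)`: the number of elements of `F_N` that are `≤ x`. -/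
def fareyPos (N : ℕ) (x : ℚ) : ℕ := ((farey N).filter (· ≤ x)).card

/-- `lcm(1, 2, …, n)`. -/
def lcmUpTo (n : ℕ) : ℕ := (Finset.Icc 1 n).lcm id

open Finset ArithmeticFunction

theorem sum_Ioc_sum_divisorsAntidiagonal {M : Type*} [AddCommMonoid M] (f : ℕ → ℕ → M) (N : ℕ) :
    ∑ n ∈ Ioc 0 N, ∑ x ∈ n.divisorsAntidiagonal, f x.1 x.2 =
      ∑ d ∈ Ioc 0 N, ∑ m ∈ Ioc 0 (N / d), f d m := by
  rw [sum_sigma', sum_sigma']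
  refine sum_bij' (fun x _ => ⟨x.2.1, x.2.2⟩) (fun x _ => ⟨x.1 * x.2, (x.1, x.2)⟩) ?_ ?_ ?_ ?_ ?_
  · rintro ⟨n, d, m⟩ h
    simp only [mem_sigma, mem_Ioc, Nat.mem_divisorsAntidiagonal] at h ⊢
    obtain ⟨⟨hn, hN⟩, rfl, -⟩ := h
    have hd : 0 < d := Nat.pos_of_mul_pos_right hn
    have hm : 0 < m := Nat.pos_of_mul_pos_left hn
    exact ⟨⟨hd, (Nat.le_mul_of_pos_right d hm).trans hN⟩, hm,
      (Nat.le_div_iff_mul_le hd).2 (by rwa [mul_comm])⟩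
  · rintro ⟨d, m⟩ h
    simp only [mem_sigma, mem_Ioc, Nat.mem_divisorsAntidiagonal] at h ⊢
    obtain ⟨⟨hd, hN⟩, hm, h⟩ := h
    have := (Nat.le_div_iff_mul_le hd).1 h
    have h0 := Nat.mul_pos hd hm
    exact ⟨⟨h0, by rwa [mul_comm]⟩, trivial, h0.ne'⟩
  · rintro ⟨n, d, m⟩ h
    simp only [mem_sigma, mem_Ioc, Nat.mem_divisorsAntidiagonal] at h ⊢
    obtain ⟨_, rfl, -⟩ := h
    rfl
  · rintro ⟨d, m⟩ h
    rfl
  · rintro ⟨n, d, m⟩ h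
    rfl

theorem sum_Ioc_moebius_mul_div {N : ℕ} (hN : 1 ≤ N) :
    ∑ d ∈ Ioc 0 N, (moebius d : ℝ) * (N / d : ℕ) = 1 := by
  have h := sum_Ioc_mul_zeta_eq_sum (R := ℝ) (moebius : ArithmeticFunction ℝ) N
  rw [coe_moebius_mul_coe_zeta] at h
  simp only [intCoe_apply] at h
  rw [← h, sum_eq_single_of_mem 1 (by simp [hN])]
  · simp
  · intro b _ hb
    simp [hb]

theorem totient_eq_sum_moebius {n : ℕ} (hn : 0 < n) :
    (n.totient : ℝ) = ∑ x ∈ n.divisorsAntidiagonal, (moebius x.1 : ℝ) * x.2 := by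
  refine ((sum_eq_iff_sum_mul_moebius_eq (R := ℝ) (f := fun n => (n.totient : ℝ))
    (g := fun n => (n : ℝ))).1 (fun n _ => ?_) n hn).symm
  exact_mod_cast n.sum_totient

theorem summable_moebius_div_sq : Summable fun n : ℕ => (moebius n : ℝ) / (n : ℝ) ^ 2 := by
  refine Summable.of_norm_bounded (Real.summable_nat_pow_inv.2 one_lt_two) fun n => ?_
  have : |(moebius n : ℝ)| ≤ 1 := by exact_mod_cast abs_moebius_le_one
  rw [norm_div, Real.norm_eq_abs, norm_pow, Real.norm_natCast, div_eq_mul_inv]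
  exact mul_le_of_le_one_left (by positivity) this

theorem tsum_moebius_div_sq : ∑' n : ℕ, (moebius n : ℝ) / (n : ℝ) ^ 2 = 6 / Real.pi ^ 2 := by
  have h2 : 1 < (2 : ℂ).re := by norm_num
  have h := LSeries_zeta_mul_Lseries_moebius h2
  rw [LSeries_zeta_eq_riemannZeta h2, riemannZeta_two] at h
  have hL : LSeries (fun n => (moebius n : ℂ)) 2
      = ((∑' n : ℕ, (moebius n : ℝ) / (n : ℝ) ^ 2 : ℝ) : ℂ) := by
    rw [LSeries, Complex.ofReal_tsum]
    refine tsum_congr fun n => ?_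
    rcases eq_or_ne n 0 with rfl | hn
    · simp
    · rw [LSeries.term_of_ne_zero hn]
      push_cast
      congr 1
      exact_mod_cast Complex.cpow_natCast (n : ℂ) 2
  rw [hL] at h
  have h' : Real.pi ^ 2 / 6 * ∑' n : ℕ, (moebius n : ℝ) / (n : ℝ) ^ 2 = 1 := by exact_mod_cast h
  have := Real.pi_pos
  field_simp at h' ⊢
  linarith

theorem abs_sum_moebius_div_sq_sub_le {N : ℕ} (hN : 1 ≤ N) :
    |∑ d ∈ Ioc 0 N, (moebius d : ℝ) / (d : ℝ) ^ 2 - 6 / Real.pi ^ 2| ≤ 1 / (N : ℝ) := by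
  have ht := summable_moebius_div_sq.hasSum.tendsto_sum_nat
  rw [tsum_moebius_div_sq] at ht
  have ht' := (tendsto_const_nhds (x := ∑ d ∈ Ioc 0 N, (moebius d : ℝ) / (d : ℝ) ^ 2)).sub
    ((Filter.tendsto_add_atTop_iff_nat 1).2 ht)
  refine le_of_tendsto ht'.abs ?_
  filter_upwards [Filter.eventually_ge_atTop N] with n hn
  have hs : ∑ i ∈ range (n + 1), (moebius i : ℝ) / (i : ℝ) ^ 2 =
      ∑ d ∈ Ioc 0 N, (moebius d : ℝ) / (d : ℝ) ^ 2
        + ∑ d ∈ Ioc N n, (moebius d : ℝ) / (d : ℝ) ^ 2 := by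
    rw [sum_Ioc_consecutive _ (Nat.zero_le _) hn, Nat.range_succ_eq_Icc_zero,
      ← add_sum_Ioc_eq_sum_Icc (Nat.zero_le _)]
    simp
  rw [hs, sub_add_cancel_left, abs_neg]
  calc |∑ d ∈ Ioc N n, (moebius d : ℝ) / (d : ℝ) ^ 2|
      ≤ ∑ d ∈ Ioc N n, |(moebius d : ℝ) / (d : ℝ) ^ 2| := abs_sum_le_sum_abs _ _
    _ ≤ ∑ d ∈ Ioc N n, ((d : ℝ) ^ 2)⁻¹ := by
        refine sum_le_sum fun d _ => ?_
        have : |(moebius d : ℝ)| ≤ 1 := by exact_mod_cast abs_moebius_le_one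
        rw [abs_div, abs_of_nonneg (by positivity : (0 : ℝ) ≤ (d : ℝ) ^ 2), div_eq_mul_inv]
        exact mul_le_of_le_one_left (by positivity) this
    _ ≤ (N : ℝ)⁻¹ - (n : ℝ)⁻¹ := sum_Ioc_inv_sq_le_sub (by omega) hn
    _ ≤ 1 / N := by
        rw [one_div]
        linarith [inv_nonneg.2 (Nat.cast_nonneg (α := ℝ) n)]

theorem sum_Ioc_cast (n : ℕ) : ∑ m ∈ Ioc 0 n, (m : ℝ) = (n : ℝ) * (n + 1) / 2 := by
  induction n with
  | zero => simp
  | succ n ih =>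
    rw [sum_Ioc_succ_top (Nat.zero_le _), ih]
    push_cast
    ring

theorem sum_totient_mul_div_sub_eq {n : ℕ} (T : ℝ) (hn : 1 ≤ n) :
    ∑ a ∈ Ioc 0 n, (a.totient : ℝ) * (T / a - 1) =
      T ^ 2 / 2 * ∑ d ∈ Ioc 0 n, (moebius d : ℝ) / (d : ℝ) ^ 2 - 1 / 2
        - ∑ d ∈ Ioc 0 n, (moebius d : ℝ) * ((T / d - (n / d : ℕ)) ^ 2 / 2) := by
  have h1 : ∀ a ∈ Ioc 0 n, (a.totient : ℝ) * (T / a - 1) =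
      ∑ x ∈ a.divisorsAntidiagonal, (moebius x.1 : ℝ) * (T / x.1 - x.2) := by
    intro a ha
    rw [totient_eq_sum_moebius (mem_Ioc.1 ha).1, sum_mul]
    refine sum_congr rfl fun x hx => ?_
    obtain ⟨rfl, h0⟩ := Nat.mem_divisorsAntidiagonal.1 hx
    have h2 : (x.1 : ℝ) ≠ 0 := by
      intro h; apply h0; simp [Nat.cast_eq_zero.1 h]
    have h3 : (x.2 : ℝ) ≠ 0 := by
      intro h; apply h0; simp [Nat.cast_eq_zero.1 h]
    push_cast
    field_simp
  rw [sum_congr rfl h1,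
    sum_Ioc_sum_divisorsAntidiagonal (fun d m : ℕ => (moebius d : ℝ) * (T / d - m))]
  have h2 := sum_Ioc_moebius_mul_div hn
  have h3 : ∀ d ∈ Ioc 0 n, ∑ m ∈ Ioc 0 (n / d), (moebius d : ℝ) * (T / d - m) =
      T ^ 2 / 2 * ((moebius d : ℝ) / (d : ℝ) ^ 2) - 1 / 2 * ((moebius d : ℝ) * (n / d : ℕ))
        - (moebius d : ℝ) * ((T / d - (n / d : ℕ)) ^ 2 / 2) := by
    intro d hd
    have hd0 : (d : ℝ) ≠ 0 := by exact_mod_cast (mem_Ioc.1 hd).1.ne'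
    rw [← mul_sum, sum_sub_distrib, sum_Ioc_cast, sum_const, Nat.card_Ioc, nsmul_eq_mul,
      Nat.sub_zero]
    field_simp
    ring
  rw [sum_congr rfl h3, sum_sub_distrib, sum_sub_distrib, ← mul_sum, ← mul_sum, h2, mul_one]

theorem abs_sum_totient_mul_div_sub_le {n : ℕ} {T : ℝ} (hn : 1 ≤ n) (hT : n ≤ T)
    (hT' : T < n + 1) :
    |∑ a ∈ Ioc 0 n, (a.totient : ℝ) * (T / a - 1) - 3 / Real.pi ^ 2 * T ^ 2| ≤ 3 * (n : ℝ) := by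
  have hn' : (1 : ℝ) ≤ n := by exact_mod_cast hn
  have h1 := abs_sum_moebius_div_sq_sub_le hn
  have h2 : |∑ d ∈ Ioc 0 n, (moebius d : ℝ) * ((T / d - (n / d : ℕ)) ^ 2 / 2)| ≤ (n : ℝ) / 2 := by
    calc _ ≤ ∑ d ∈ Ioc 0 n, |(moebius d : ℝ) * ((T / d - (n / d : ℕ)) ^ 2 / 2)| :=
          abs_sum_le_sum_abs _ _
      _ ≤ ∑ d ∈ Ioc 0 n, (1 / 2 : ℝ) := by
          refine sum_le_sum fun d hd => ?_
          have hd0 : (0 : ℝ) < d := by exact_mod_cast (mem_Ioc.1 hd).1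
          have hm : |(moebius d : ℝ)| ≤ 1 := by exact_mod_cast abs_moebius_le_one
          have hlo : ((n / d : ℕ) : ℝ) ≤ T / d := Nat.cast_div_le.trans (by gcongr)
          have hhi : T / d ≤ (n / d : ℕ) + 1 := by
            rw [div_le_iff₀ hd0]
            refine hT'.le.trans ?_
            have := Nat.lt_mul_div_succ n (mem_Ioc.1 hd).1
            rw [mul_comm] at this
            exact_mod_cast this
          rw [abs_mul, abs_of_nonneg (by positivity : (0 : ℝ) ≤ (T / d - (n / d : ℕ)) ^ 2 / 2)]
          refine (mul_le_of_le_one_left (by positivity) hm).trans ?_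
          nlinarith
      _ = n / 2 := by simp; ring
  have h3 : |T ^ 2 / 2 * (∑ d ∈ Ioc 0 n, (moebius d : ℝ) / (d : ℝ) ^ 2 - 6 / Real.pi ^ 2)|
      ≤ 2 * (n : ℝ) := by
    rw [abs_mul, abs_of_nonneg (by positivity)]
    have hT0 : 0 ≤ T := by linarith
    have hT2 : T ≤ 2 * n := by linarith
    calc _ ≤ (2 * n : ℝ) ^ 2 / 2 * (1 / n) := by gcongr
      _ = 2 * n := by field_simp
  rw [sum_totient_mul_div_sub_eq T hn]
  have h4 : 3 / Real.pi ^ 2 * T ^ 2 = T ^ 2 / 2 * (6 / Real.pi ^ 2) := by ring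
  rw [mul_sub] at h3
  rw [h4]
  rw [abs_le] at h2 h3 ⊢
  constructor <;> linarith [h2.1, h2.2, h3.1, h3.2]

theorem mem_farey_iff {N : ℕ} {r : ℚ} (hN : 1 ≤ N) :
    r ∈ farey N ↔ 0 ≤ r ∧ r ≤ 1 ∧ r.den ≤ N := by
  simp only [farey, mem_biUnion, mem_image, mem_range]
  constructor
  · rintro ⟨k, hk, h, hh, rfl⟩
    refine ⟨by positivity, div_le_one_of_le₀ (by exact_mod_cast Nat.lt_succ_iff.1 hh)
      (Nat.cast_nonneg k), ?_⟩
    rcases Nat.eq_zero_or_pos k with rfl | hk0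
    · simpa using hN
    · have h1 : ((((h : ℤ) : ℚ) / ((k : ℤ) : ℚ)).den : ℤ) ∣ (k : ℤ) := by
        rw [← Rat.divInt_eq_div]
        exact Rat.den_dvd _ _
      have h2 := Nat.le_of_dvd hk0 (Int.natCast_dvd_natCast.1 h1)
      push_cast at h2
      omega
  · rintro ⟨h0, h1, hd⟩
    have hn : (r.num.toNat : ℤ) = r.num := Int.toNat_of_nonneg (Rat.num_nonneg.2 h0)
    have hle := Rat.le_iff r 1
    simp only [Rat.num_ofNat, Rat.den_ofNat] at hle
    have hle := hle.1 h1
    refine ⟨r.den, by omega, r.num.toNat, by push_cast at hle; omega, ?_⟩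
    have : ((r.num.toNat : ℕ) : ℚ) = (r.num : ℚ) := by exact_mod_cast congrArg (Int.cast (R := ℚ)) hn
    rw [this, Rat.num_div_den]

theorem one_sub_mem_farey {N : ℕ} {r : ℚ} (hN : 1 ≤ N) (hr : r ∈ farey N) : 1 - r ∈ farey N := by
  rw [mem_farey_iff hN] at hr ⊢
  refine ⟨by linarith [hr.2.1], by linarith [hr.1], ?_⟩
  simp only [Rat.ofNat_sub_den]
  exact hr.2.2

theorem two_mul_fareyPos {N : ℕ} {x : ℚ} (hN : 2 ≤ N) (hx : 1 / 2 ≤ x) :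
    2 * fareyPos N x = #(farey N) + 1 + 2 * #{r ∈ farey N | 1 / 2 < r ∧ r ≤ x} := by
  have hN1 : 1 ≤ N := by omega
  have hsymm : #{r ∈ farey N | r < 1 / 2} = #{r ∈ farey N | 1 / 2 < r} := by
    refine card_nbij' (fun r => 1 - r) (fun r => 1 - r) ?_ ?_ ?_ ?_
    · intro r hr
      simp only [coe_filter, Set.mem_ofPred_eq] at hr ⊢
      exact ⟨one_sub_mem_farey hN1 hr.1, by linarith [hr.2]⟩
    · intro r hr
      simp only [coe_filter, Set.mem_ofPred_eq] at hr ⊢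
      exact ⟨one_sub_mem_farey hN1 hr.1, by linarith [hr.2]⟩
    · intro r _
      simp
    · intro r _
      simp
  have hhalf : #{r ∈ farey N | r = 1 / 2} = 1 := by
    rw [card_eq_one]
    refine ⟨1 / 2, ?_⟩
    ext r
    simp only [mem_filter, mem_singleton, and_iff_right_iff_imp]
    rintro rfl
    rw [mem_farey_iff hN1]
    refine ⟨by norm_num, by norm_num, ?_⟩
    norm_num
    exact hN
  have htot : #(farey N) =
      #{r ∈ farey N | r < 1 / 2} + #{r ∈ farey N | r = 1 / 2} + #{r ∈ farey N | 1 / 2 < r} := by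
    rw [← card_union_of_disjoint, ← card_union_of_disjoint]
    · congr 1
      ext r
      simp only [mem_union, mem_filter]
      have := lt_trichotomy r (1 / 2)
      tauto
    · rw [disjoint_left]
      intro r hr
      simp only [mem_union, mem_filter] at hr ⊢
      rintro ⟨_, h⟩
      rcases hr with ⟨_, h'⟩ | ⟨_, h'⟩ <;> linarith
    · rw [disjoint_left]
      intro r hr
      simp only [mem_filter] at hr ⊢
      rintro ⟨_, h⟩
      linarith [hr.2]
  have hpos : fareyPos N x = #{r ∈ farey N | r < 1 / 2} + #{r ∈ farey N | r = 1 / 2}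
      + #{r ∈ farey N | 1 / 2 < r ∧ r ≤ x} := by
    rw [← card_union_of_disjoint, ← card_union_of_disjoint, fareyPos]
    · congr 1
      ext r
      simp only [mem_union, mem_filter]
      have h3 := lt_trichotomy r (1 / 2)
      have h4 : r < 1 / 2 → r ≤ x := fun h => by linarith
      have h5 : r = 1 / 2 → r ≤ x := fun h => by linarith
      tauto
    · rw [disjoint_left]
      intro r hr
      simp only [mem_union, mem_filter] at hr ⊢
      rintro ⟨_, h, _⟩
      rcases hr with ⟨_, h'⟩ | ⟨_, h'⟩ <;> linarith
    · rw [disjoint_left]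
      intro r hr
      simp only [mem_filter] at hr ⊢
      rintro ⟨_, h⟩
      linarith [hr.2]
  omega

theorem num_den_natCast_div_two_mul_sub {a h : ℕ} (ha : 0 < a) (hah : a ≤ h)
    (hc : a.Coprime h) :
    ((h : ℚ) / ((2 * h - a : ℕ) : ℚ)).num = h ∧
      ((h : ℚ) / ((2 * h - a : ℕ) : ℚ)).den = 2 * h - a := by
  have hc' : Nat.Coprime h (2 * h - a) := by
    have hdvd : Nat.gcd h (2 * h - a) ∣ a := by
      have h1 := Nat.dvd_sub ((Nat.gcd_dvd_left h (2 * h - a)).mul_left 2)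
        (Nat.gcd_dvd_right h (2 * h - a))
      rwa [Nat.sub_sub_self (by omega)] at h1
    exact Nat.eq_one_of_dvd_coprimes hc hdvd (Nat.gcd_dvd_left _ _)
  have h1 := Rat.num_div_eq_of_coprime (a := (h : ℤ)) (b := ((2 * h - a : ℕ) : ℤ))
    (by omega) (by simpa using hc')
  have h2 := Rat.den_div_eq_of_coprime (a := (h : ℤ)) (b := ((2 * h - a : ℕ) : ℤ))
    (by omega) (by simpa using hc')
  rw [Int.cast_natCast, Int.cast_natCast] at h1 h2
  exact ⟨h1, by exact_mod_cast h2⟩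

theorem card_farey_filter_half_lt {L q i : ℕ} (hL : 1 ≤ L) (hq : 1 ≤ q) (hi : L < q * (i + 1)) :
    #{r ∈ farey (2 * L) | 1 / 2 < r ∧ r ≤ ((q : ℚ) + 1) / (2 * q + 1)} =
      ∑ a ∈ Ioc 0 i, #{h ∈ Icc (a * (q + 1)) (L + a / 2) | a.Coprime h} := by
  rw [← card_sigma]
  symm
  refine card_nbij' (fun p : (_ : ℕ) × ℕ => (p.2 : ℚ) / ((2 * p.2 - p.1 : ℕ) : ℚ))
    (fun r => ⟨2 * r.num.toNat - r.den, r.num.toNat⟩) ?_ ?_ ?_ ?_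
  · rintro ⟨a, h⟩ hp
    simp only [coe_sigma, Set.mem_sigma_iff, mem_coe, mem_Ioc, mem_filter, mem_Icc] at hp ⊢
    obtain ⟨⟨ha, hai⟩, ⟨h1, h2⟩, hc⟩ := hp
    have hah : a ≤ h := (Nat.le_mul_of_pos_right a (by omega)).trans h1
    have hk : ((2 * h - a : ℕ) : ℚ) = 2 * h - a := by
      rw [Nat.cast_sub (by omega)]; push_cast; rfl
    have haQ : (0 : ℚ) < a := by exact_mod_cast ha
    have hahQ : (a : ℚ) ≤ h := by exact_mod_cast hah
    have hkpos : (0 : ℚ) < 2 * h - a := by linarith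
    rw [mem_farey_iff (by omega), (num_den_natCast_div_two_mul_sub ha hah hc).2, hk]
    refine ⟨⟨by positivity, (div_le_one hkpos).2 (by linarith), by omega⟩, ?_, ?_⟩
    · rw [div_lt_div_iff₀ two_pos hkpos]
      linarith
    · rw [div_le_div_iff₀ hkpos (by positivity)]
      have : (a : ℚ) * (q + 1) ≤ h := by exact_mod_cast h1
      linarith
  · intro r hr
    simp only [coe_sigma, Set.mem_sigma_iff, mem_coe, mem_Ioc, mem_filter, mem_Icc] at hr ⊢
    obtain ⟨hr, hlo, hhi⟩ := hr
    rw [mem_farey_iff (by omega)] at hr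
    obtain ⟨h0, h1, hd⟩ := hr
    obtain ⟨n, hn⟩ := Int.eq_ofNat_of_zero_le (Rat.num_nonneg.2 h0)
    have hred := r.reduced
    have hdpos := r.den_pos
    have hr' : r = (n : ℚ) / r.den := by
      conv_lhs => rw [← Rat.num_div_den r, hn]
      simp
    rw [hn] at hred ⊢
    simp only [Int.natAbs_natCast, Int.toNat_natCast] at hred ⊢
    generalize r.den = k at *
    subst hr'
    have hkQ : (0 : ℚ) < k := by exact_mod_cast hdpos
    rw [div_lt_div_iff₀ two_pos hkQ] at hlo
    rw [div_le_div_iff₀ hkQ (by positivity)] at hhi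
    have hlo' : k < 2 * n := by
      have : (k : ℚ) < 2 * n := by linarith
      exact_mod_cast this
    have hhi' : n * (2 * q + 1) ≤ (q + 1) * k := by exact_mod_cast hhi
    obtain ⟨a, ha⟩ := Nat.exists_eq_add_of_lt hlo'
    have ha' : 2 * n - k = a + 1 := by omega
    rw [ha']
    have hmul : (a + 1) * (q + 1) ≤ n := by nlinarith
    have hcop : Nat.Coprime (a + 1) n := by
      have : Nat.gcd (a + 1) n ∣ k := by
        have h1 := Nat.dvd_sub ((Nat.gcd_dvd_right (a + 1) n).mul_left 2)
          (Nat.gcd_dvd_left (a + 1) n)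
        rwa [show 2 * n - (a + 1) = k by omega] at h1
      exact Nat.eq_one_of_dvd_coprimes hred (Nat.gcd_dvd_right _ _) this
    refine ⟨⟨by omega, ?_⟩, ⟨hmul, by omega⟩, hcop⟩
    by_contra! hlt
    have hge : i + 1 ≤ a + 1 := hlt
    have : q * (i + 1) ≤ q * (a + 1) := by gcongr
    nlinarith
  · rintro ⟨a, h⟩ hp
    simp only [coe_sigma, Set.mem_sigma_iff, mem_coe, mem_Ioc, mem_filter, mem_Icc] at hp ⊢
    obtain ⟨⟨ha, hai⟩, ⟨h1, h2⟩, hc⟩ := hp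
    have hah : a ≤ h := (Nat.le_mul_of_pos_right a (by omega)).trans h1
    obtain ⟨hnum, hden⟩ := num_den_natCast_div_two_mul_sub ha hah hc
    rw [hnum, hden, Int.toNat_natCast, Nat.sub_sub_self (by omega)]
  · intro r hr
    simp only [mem_coe, mem_filter] at hr ⊢
    obtain ⟨hr, hlo, -⟩ := hr
    have h0 : 0 ≤ r.num := Rat.num_nonneg.2 (by linarith)
    have hn : ((r.num.toNat : ℕ) : ℚ) = (r.num : ℚ) := by
      exact_mod_cast congrArg (Int.cast (R := ℚ)) (Int.toNat_of_nonneg h0)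
    have hle : r.den ≤ 2 * r.num.toNat := by
      have hkQ : (0 : ℚ) < r.den := by exact_mod_cast r.den_pos
      rw [← Rat.num_div_den r, ← hn, div_lt_div_iff₀ two_pos hkQ] at hlo
      have : (r.den : ℚ) ≤ 2 * (r.num.toNat : ℕ) := by linarith
      exact_mod_cast this
    rw [Nat.sub_sub_self hle, hn, Rat.num_div_den]

theorem abs_card_coprime_sub_le {a q M : ℕ} (ha : 1 ≤ a) (hM : q ≤ M) :
    |(#{h ∈ Icc (a * (q + 1)) (a * M + a / 2) | a.Coprime h} : ℝ)
      - (a.totient : ℝ) * ((M : ℝ) - q)| ≤ (a : ℝ) := by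
  have hper : ∀ t n : ℕ, #{h ∈ Ico n (n + a * t) | a.Coprime h} = t * a.totient := by
    intro t n
    induction t with
    | zero => simp
    | succ t ih =>
      rw [← Ico_union_Ico_eq_Ico (b := n + a * t) (by omega) (by gcongr; omega), filter_union,
        card_union_of_disjoint (disjoint_filter_filter (Ico_disjoint_Ico_consecutive _ _ _)), ih,
        Nat.mul_succ, ← add_assoc, Nat.filter_coprime_Ico_eq_totient]
      ring
  obtain ⟨t, rfl⟩ := Nat.exists_eq_add_of_le hM
  have hup : #{h ∈ Icc (a * (q + 1)) (a * (q + t) + a / 2) | a.Coprime h} ≤ t * a.totient := by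
    rw [← hper t (a * (q + 1))]
    refine card_le_card (filter_subset_filter _ fun h hh => ?_)
    rw [mem_Icc] at hh
    rw [mem_Ico]
    refine ⟨hh.1, ?_⟩
    have : a / 2 < a := Nat.div_lt_self ha one_lt_two
    linarith [hh.2]
  have hlow : (t - 1) * a.totient ≤
      #{h ∈ Icc (a * (q + 1)) (a * (q + t) + a / 2) | a.Coprime h} := by
    rcases t with _ | t
    · simp
    rw [Nat.add_sub_cancel, ← hper t (a * (q + 1))]
    refine card_le_card (filter_subset_filter _ fun h hh => ?_)
    rw [mem_Ico] at hh
    rw [mem_Icc]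
    refine ⟨hh.1, ?_⟩
    have : a * (q + (t + 1)) = a * (q + 1) + a * t := by ring
    omega
  have hlow' : (t : ℝ) * a.totient ≤
      #{h ∈ Icc (a * (q + 1)) (a * (q + t) + a / 2) | a.Coprime h} + a.totient := by
    have : t * a.totient ≤ (t - 1) * a.totient + a.totient := by
      rw [← Nat.succ_mul]
      gcongr
      omega
    exact_mod_cast this.trans (by gcongr)
  have hup' : (#{h ∈ Icc (a * (q + 1)) (a * (q + t) + a / 2) | a.Coprime h} : ℝ) ≤
      t * a.totient := by exact_mod_cast hup
  have hphi : (a.totient : ℝ) ≤ a := by exact_mod_cast Nat.totient_le a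
  have hphi0 : (0 : ℝ) ≤ a.totient := Nat.cast_nonneg _
  push_cast
  rw [abs_le]
  constructor <;> linarith

theorem mul_self_le_two_mul_lcmUpTo {n : ℕ} (hn : 1 ≤ n) : n * n ≤ 2 * lcmUpTo n := by
  have hdvd : ∀ k, 1 ≤ k → k ≤ n → k ∣ lcmUpTo n := fun k h1 h2 =>
    dvd_lcm (f := id) (mem_Icc.2 ⟨h1, h2⟩)
  have hpos : 0 < lcmUpTo n := by
    refine Nat.pos_of_ne_zero fun h => ?_
    rw [lcmUpTo, Finset.lcm_eq_zero_iff] at h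
    simp at h
  obtain _ | _ | m := n
  · omega
  · omega
  · have hc : Nat.Coprime (m + 1) (m + 1 + 1) := by simp
    have := Nat.le_of_dvd hpos
      (hc.mul_dvd_of_dvd_of_dvd (hdvd (m + 1) (by omega) (by omega)) (hdvd _ (by omega) le_rfl))
    nlinarith

/-- there is `C > 0` such that for `N = 2·lcm(1,…,i_max)`,
`1 ≤ i ≤ i_max` and `N/(2(i+1)) < q ≤ N/(2i)`,
`| I_N((q+1)/(2q+1)) − |F_N|/2 − (3/π²)·N²/(4q) | ≤ C·N`. -/
theorem stmt_10 :
    ∃ C : ℝ, 0 < C ∧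
      ∀ imax i q N : ℕ,
        1 ≤ imax → 1 ≤ i → i ≤ imax →
        N = 2 * lcmUpTo imax →
        (N : ℝ) / (2 * (i + 1)) < q → (q : ℝ) ≤ (N : ℝ) / (2 * i) →
        |(fareyPos N (((q : ℚ) + 1) / (2 * (q : ℚ) + 1)) : ℝ)
            - ((farey N).card : ℝ) / 2
            - 3 / Real.pi ^ 2 * (N : ℝ) ^ 2 / (4 * q)|
          ≤ C * N := by
  refine ⟨5, by norm_num, ?_⟩
  intro imax i q N himax hi hii hN hq1 hq2
  have hsq := mul_self_le_two_mul_lcmUpTo himax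
  have hdvd : ∀ a ∈ Ioc 0 i, a ∣ lcmUpTo imax := fun a ha =>
    dvd_lcm (f := id) (mem_Icc.2 ⟨(mem_Ioc.1 ha).1, (mem_Ioc.1 ha).2.trans hii⟩)
  generalize lcmUpTo imax = L at *
  subst hN
  have hiR : (1 : ℝ) ≤ i := by exact_mod_cast hi
  have hLq : (L : ℝ) < q * (i + 1) := by
    rw [div_lt_iff₀ (by positivity)] at hq1
    push_cast at hq1
    linarith
  have hqL : (q : ℝ) * i ≤ L := by
    rw [le_div_iff₀ (by positivity)] at hq2
    push_cast at hq2
    linarith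
  have hLq' : L < q * (i + 1) := by exact_mod_cast hLq
  have hqL' : q * i ≤ L := by exact_mod_cast hqL
  have hq : 1 ≤ q := Nat.pos_of_ne_zero fun h => by simp [h] at hLq'
  have hqR : (0 : ℝ) < q := by exact_mod_cast hq
  have hL : 1 ≤ L := (Nat.mul_pos hq hi).trans_le hqL'
  have hLR : (1 : ℝ) ≤ L := by exact_mod_cast hL
  have hisq : (i : ℝ) * i ≤ 2 * L := by
    exact_mod_cast (Nat.mul_le_mul hii hii).trans hsq
  have hx : (1 : ℚ) / 2 ≤ ((q : ℚ) + 1) / (2 * q + 1) := by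
    rw [div_le_div_iff₀ two_pos (by positivity)]
    linarith
  have hpos := two_mul_fareyPos (N := 2 * L) (by omega) hx
  rw [card_farey_filter_half_lt hL hq hLq'] at hpos
  have hposR := congrArg (Nat.cast (R := ℝ)) hpos
  push_cast at hposR
  have hcount : |∑ a ∈ Ioc 0 i, (#{h ∈ Icc (a * (q + 1)) (L + a / 2) | a.Coprime h} : ℝ)
      - q * ∑ a ∈ Ioc 0 i, (a.totient : ℝ) * ((L / q : ℝ) / a - 1)| ≤ (i : ℝ) * i := by
    rw [mul_sum, ← sum_sub_distrib]
    refine (abs_sum_le_sum_abs _ _).trans ?_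
    calc _ ≤ ∑ a ∈ Ioc 0 i, (i : ℝ) := by
          refine sum_le_sum fun a ha => ?_
          obtain ⟨M, hM⟩ := hdvd a ha
          obtain ⟨ha0, hai⟩ := mem_Ioc.1 ha
          have hqM : q ≤ M := by
            refine Nat.le_of_mul_le_mul_left ?_ ha0
            rw [← hM, mul_comm]
            exact (Nat.mul_le_mul_left q hai).trans hqL'
          have haR : (0 : ℝ) < a := by exact_mod_cast ha0
          have hterm : (q : ℝ) * ((a.totient : ℝ) * ((L / q : ℝ) / a - 1)) =
              (a.totient : ℝ) * ((M : ℝ) - q) := by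
            rw [hM]
            push_cast
            field_simp
          rw [hterm, hM]
          exact (abs_card_coprime_sub_le ha0 hqM).trans (by exact_mod_cast hai)
      _ = i * i := by simp
  have hmain := abs_sum_totient_mul_div_sub_le hi (T := (L / q : ℝ))
    (by rw [le_div_iff₀ hqR]; linarith) (by rw [div_lt_iff₀ hqR]; linarith)
  have hmain' : |(q : ℝ) * ∑ a ∈ Ioc 0 i, (a.totient : ℝ) * ((L / q : ℝ) / a - 1)
      - 3 / Real.pi ^ 2 * ((2 * L : ℕ) : ℝ) ^ 2 / (4 * q)| ≤ 3 * (L : ℝ) := by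
    have h1 : 3 / Real.pi ^ 2 * ((2 * L : ℕ) : ℝ) ^ 2 / (4 * q) =
        q * (3 / Real.pi ^ 2 * (L / q : ℝ) ^ 2) := by
      push_cast
      field_simp
      norm_num
    rw [h1, ← mul_sub, abs_mul, abs_of_pos hqR]
    nlinarith
  rw [abs_le] at hcount hmain' ⊢
  push_cast at hmain' ⊢
  constructor <;> linarith [hcount.1, hcount.2, hmain'.1, hmain'.2]
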